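/- arXiv:0711.3155 — 3 statements merged into one kernel-verified Lean document; each statement's English description precedes it below -/
import Mathlib

section
/- Existence of Jost solutions (Theorem 4.2, evanescent case): Assume V satisfies assumption (A) and m > 0. For E in region II (resp. region IV), the equation (H − E)u = 0 possesses two Jost solutions ω_in^−, ω_out^− (resp. ω_in^+, ω_out^+) with the oscillatory asymptotics ω_in^∓ ~ exp(±(i/(hc))Φ(E−V^∓)x)·(A(E−V^∓), ±A(E−V^∓)^{−1})ᵀ and ω_out^∓ ~ exp(∓(i/(hc))Φ(E−V^∓)x)·(A(E−V^∓), ∓A(E−V^∓)^{−1})ᵀ as x → ∓∞, together with a decaying solution ω_d^+ (resp. ω_d^−) which behaves exactly like ω_d^± ~ exp(∓(1/(hc))√(m²c⁴ − (V^± − E)²)·x)·(∓i((mc² + E − V^±)/(mc² − E + V^±))^{1/4}, ((mc² − E + V^±)/(mc² + E − V^±))^{1/4})ᵀ as x → ±∞. -/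
open Complex Filter Topology MeasureTheory Set

noncomputable section

/-- The sector `𝒮 = {x ∈ ℂ : |Im x| < ε|Re x| + η}`. -/
def Sector (ε η : ℝ) : Set ℂ := {x : ℂ | |x.im| < ε * |x.re| + η}

/-- Assumption (A): `V` is real on the real axis, analytic in a sector `𝒮`
around the real axis, and tends to constants `V^±` at `±∞` in `𝒮` at rate
`⟨x⟩^{-δ}`, `δ > 1`, with `V⁻ < V⁺`. -/
structure AssumptionA (V : ℂ → ℂ) (Vm Vp : ℝ) : Prop where
  lt : Vm < Vp
  real_on_real : ∀ x : ℝ, (V x).im = 0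
  sector : ∃ ε > (0 : ℝ), ∃ η > (0 : ℝ), ∃ δ > (1 : ℝ),
    AnalyticOnNhd ℂ V (Sector ε η) ∧
    (∃ C R : ℝ, ∀ x ∈ Sector ε η, R ≤ x.re →
      ‖V x - (Vp : ℂ)‖ ≤ C * (1 + ‖x‖ ^ 2) ^ (-(δ / 2))) ∧
    (∃ C R : ℝ, ∀ x ∈ Sector ε η, x.re ≤ -R →
      ‖V x - (Vm : ℂ)‖ ≤ C * (1 + ‖x‖ ^ 2) ^ (-(δ / 2)))

/-- `u = (u₁,u₂)` solves the one-dimensional Dirac equation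
`(-i h c σ₁ d/dx + m c² σ₃ + V(x) I₂) u = E u` on `ℝ`. -/
structure IsDiracSolution (hp m c : ℝ) (V : ℂ → ℂ) (E : ℝ) (u : ℝ → ℂ × ℂ) : Prop where
  diff1 : Differentiable ℝ fun x : ℝ => (u x).1
  diff2 : Differentiable ℝ fun x : ℝ => (u x).2
  eq1 : ∀ x : ℝ,
    -Complex.I * (hp : ℂ) * (c : ℂ) * deriv (fun y : ℝ => (u y).2) x
      + ((m : ℂ) * (c : ℂ) ^ 2 + V x) * (u x).1 = (E : ℂ) * (u x).1
  eq2 : ∀ x : ℝ,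
    -Complex.I * (hp : ℂ) * (c : ℂ) * deriv (fun y : ℝ => (u y).1) x
      + (-((m : ℂ) * (c : ℂ) ^ 2) + V x) * (u x).2 = (E : ℂ) * (u x).2

/-- `Φ(λ) = sgn(λ) √(λ² − m²c⁴)`. -/
def PhiF (m c lam : ℝ) : ℝ := Real.sign lam * Real.sqrt (lam ^ 2 - m ^ 2 * c ^ 4)

/-- `A(λ) = ((λ + mc²)/(λ − mc²))^{1/4}`. -/
def AmpF (m c lam : ℝ) : ℝ := ((lam + m * c ^ 2) / (lam - m * c ^ 2)) ^ ((1 : ℝ) / 4)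

/-- `u(x)` behaves exactly like `e^{θ x} v` along the filter `l`,
i.e. `u(x) e^{-θ x} → v`. -/
def JostAsymp (u : ℝ → ℂ × ℂ) (θ : ℂ) (v : ℂ × ℂ) (l : Filter ℝ) : Prop :=
  Tendsto (fun x : ℝ => (u x).1 * Complex.exp (-(θ * (x : ℂ)))) l (𝓝 v.1) ∧
  Tendsto (fun x : ℝ => (u x).2 * Complex.exp (-(θ * (x : ℂ)))) l (𝓝 v.2)

/-- `u` behaves exactly like `exp(s (i/(hc)) Φ(E−V₀) x) · (A(E−V₀), s' A(E−V₀)⁻¹)`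
along `l`.  The Jost solutions `ω_in^±` correspond to `s = s' = ∓1`, `l = at±∞`,
and `ω_out^±` to `s = s' = ±1`, `l = at±∞`. -/
def JostCond (hp m c E V0 s s' : ℝ) (l : Filter ℝ) (u : ℝ → ℂ × ℂ) : Prop :=
  JostAsymp u ((s : ℂ) * Complex.I / ((hp : ℂ) * (c : ℂ)) * ((PhiF m c (E - V0) : ℝ) : ℂ))
    (((AmpF m c (E - V0) : ℝ) : ℂ), (s' : ℂ) * (((AmpF m c (E - V0) : ℝ) : ℂ))⁻¹) l

/-- `B^± = ((mc² + E − V^±)/(mc² − E + V^±))^{1/4}`. -/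
def Bsym (m c E W : ℝ) : ℝ := ((m * c ^ 2 + E - W) / (m * c ^ 2 - E + W)) ^ ((1 : ℝ) / 4)

/-- The decaying Jost solution `ω_d^±` (for `s = ±1`, `l = at±∞`):
`ω_d^± ~ exp(∓ (1/(hc)) √(m²c⁴ − (V^± − E)²) x) (∓ i B^±, (B^±)⁻¹)`. -/
def DecayCond (hp m c E W s : ℝ) (l : Filter ℝ) (u : ℝ → ℂ × ℂ) : Prop :=
  JostAsymp u (-(s : ℂ) * ((Real.sqrt (m ^ 2 * c ^ 4 - (W - E) ^ 2) : ℝ) : ℂ) / ((hp : ℂ) * (c : ℂ)))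
    (-(s : ℂ) * Complex.I * ((Bsym m c E W : ℝ) : ℂ), (((Bsym m c E W : ℝ) : ℂ))⁻¹) l

/-- The defining relation `(ω_in^−, ω_in^+) = (ω_out^+, ω_out^−) · 𝕊` of the
scattering matrix. -/
def ScatRel (ωinm ωinp ωoutp ωoutm : ℝ → ℂ × ℂ) (S : Matrix (Fin 2) (Fin 2) ℂ) : Prop :=
  (∀ x : ℝ, ωinm x = S 0 0 • ωoutp x + S 1 0 • ωoutm x) ∧
  (∀ x : ℝ, ωinp x = S 0 1 • ωoutp x + S 1 1 • ωoutm x)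

/-- A classical analytic symbol (of non-negative order `mo`) in the semiclassical
parameter `h`: there are coefficients `a j` with `‖a j‖ ≤ C^{j+1} j^j` such that
`f(h) − ∑_{0 ≤ j ≤ h⁻¹/(e C₁)} a j h^{mo+j}` is `O(e^{-ρ/h})` for every `C₁ > C`. -/
def IsCAS (f : ℝ → ℂ) : Prop :=
  ∃ (mo : ℕ) (a : ℕ → ℂ) (C : ℝ), 0 < C ∧
    (∀ j : ℕ, ‖a j‖ ≤ C ^ (j + 1) * (j : ℝ) ^ j) ∧
    ∀ C₁ : ℝ, C < C₁ → ∃ ρ > (0 : ℝ), ∃ M : ℝ,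
      ∀ h : ℝ, 0 < h → h < 1 →
        ‖f h - ∑ j ∈ Finset.range (⌊1 / (h * Real.exp 1 * C₁)⌋₊ + 1), a j * (h : ℂ) ^ (mo + j)‖
          ≤ M * Real.exp (-ρ / h)

/-- `E^± = (−m²c⁴ + (V^± − E)²)/c²`. -/
def Esym (m c E W : ℝ) : ℝ := (-(m ^ 2 * c ^ 4) + (W - E) ^ 2) / c ^ 2

/-- `Q^±(t,E) = √((−m²c⁴ + (V(t) − E)²)/c²) − √(E^±)` (here `W = V^±`). -/
def Qsym (m c E W : ℝ) (V : ℂ → ℂ) (t : ℝ) : ℝ :=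
  Real.sqrt ((-(m ^ 2 * c ^ 4) + ((V t).re - E) ^ 2) / c ^ 2) - Real.sqrt (Esym m c E W)

/-- `Q₋^±(t,E) = √((m²c⁴ − (V(t) − E)²)/c²) − √(−E^±)` (here `W = V^±`). -/
def Qminus (m c E W : ℝ) (V : ℂ → ℂ) (t : ℝ) : ℝ :=
  Real.sqrt ((m ^ 2 * c ^ 4 - ((V t).re - E) ^ 2) / c ^ 2) - Real.sqrt (-(Esym m c E W))

/-- The classical action `S(E)` between the turning points. -/
def SAct (m c E : ℝ) (V : ℂ → ℂ) (t₁ t₂ : ℝ) : ℝ :=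
  ∫ t in t₁..t₂, Real.sqrt ((m ^ 2 * c ^ 4 - ((V t).re - E) ^ 2) / c ^ 2)

/-- The phase `T(E)`. -/
def TPhase (m c E Vm Vp : ℝ) (V : ℂ → ℂ) (t₁ t₂ : ℝ) : ℝ :=
  (∫ t in Set.Iic t₁, Qsym m c E Vm V t) - (∫ t in Set.Ici t₂, Qsym m c E Vp V t)
    + t₁ * Real.sqrt (Esym m c E Vm) + t₂ * Real.sqrt (Esym m c E Vp)

/-- The Wronskian of two vectors in `ℂ²`. -/
def Wron (u v : ℂ × ℂ) : ℂ := u.1 * v.2 - u.2 * v.1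

end

section VolterraIoi

variable {F : Type*} [NormedAddCommGroup F] [NormedSpace ℝ F]

theorem hasDerivAt_setIntegral_Ioi [CompleteSpace F] {g : ℝ → F} (hg : Continuous g)
    (hi : ∀ a, IntegrableOn g (Ioi a)) (x : ℝ) :
    HasDerivAt (fun y => ∫ s in Ioi y, g s) (-g x) x := by
  have h : (fun y => ∫ s in Ioi y, g s) =
      fun y => (∫ s in Ioi (0 : ℝ), g s) - ∫ s in (0 : ℝ)..y, g s := by
    funext y
    rw [← intervalIntegral.integral_interval_add_Ioi (hi 0) (hi y), add_sub_cancel_left]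
  rw [h]
  exact (hg.integral_hasStrictDerivAt 0 x).hasDerivAt.const_sub _

theorem tendsto_setIntegral_Ioi_zero {g : ℝ → F} (hi : ∀ a, IntegrableOn g (Ioi a)) :
    Tendsto (fun y => ∫ s in Ioi y, g s) atTop (𝓝 0) := by
  have h : (fun y => ∫ s in Ioi y, g s) =
      fun y => (∫ s in Ioi (0 : ℝ), g s) - ∫ s in (0 : ℝ)..y, g s := by
    funext y
    rw [← intervalIntegral.integral_interval_add_Ioi (hi 0) (hi y), add_sub_cancel_left]
  rw [h]
  simpa using (intervalIntegral_tendsto_integral_Ioi 0 (hi 0) tendsto_id).const_sub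
    (∫ s in Ioi (0 : ℝ), g s)

/-- The exponential weight controlling the size of solutions of the Volterra equation. -/
noncomputable def tailWeight (μ : ℝ) (r : ℝ → ℂ) (x : ℝ) : ℝ := Real.exp (μ * ∫ s in Ioi x, ‖r s‖)

section Weight

variable {μ : ℝ} {r : ℝ → ℂ}

theorem tailWeight_pos (x : ℝ) : 0 < tailWeight μ r x := Real.exp_pos _

theorem continuous_tailWeight (hr : Continuous r) (hi : ∀ a, IntegrableOn r (Ioi a)) :
    Continuous (tailWeight μ r) := by
  have h : Continuous fun x => ∫ s in Ioi x, ‖r s‖ := continuous_iff_continuousAt.2 fun x =>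
    (hasDerivAt_setIntegral_Ioi hr.norm (fun a => (hi a).norm) x).continuousAt
  unfold tailWeight
  fun_prop

theorem one_le_tailWeight (hμ : 0 ≤ μ) (x : ℝ) : 1 ≤ tailWeight μ r x :=
  Real.one_le_exp (mul_nonneg hμ (integral_nonneg fun _ => norm_nonneg _))

theorem tailWeight_anti (hμ : 0 ≤ μ) (hi : ∀ a, IntegrableOn r (Ioi a)) :
    Antitone (tailWeight μ r) := fun a b hab => by
  refine Real.exp_le_exp.2 (mul_le_mul_of_nonneg_left ?_ hμ)
  exact setIntegral_mono_set (hi a).norm (ae_of_all _ fun _ => norm_nonneg _)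
    (Ioi_subset_Ioi hab).eventuallyLE

theorem integrableOn_norm_mul_tailWeight (hμ : 0 ≤ μ) (hr : Continuous r)
    (hi : ∀ a, IntegrableOn r (Ioi a)) (a : ℝ) :
    IntegrableOn (fun s => ‖r s‖ * tailWeight μ r s) (Ioi a) := by
  refine Integrable.mono' ((hi a).norm.mul_const (tailWeight μ r a))
    (hr.norm.mul (continuous_tailWeight hr hi)).aestronglyMeasurable ?_
  filter_upwards [ae_restrict_mem measurableSet_Ioi] with s hs
  rw [norm_mul, norm_norm, Real.norm_of_nonneg (tailWeight_pos s).le]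
  exact mul_le_mul_of_nonneg_left (tailWeight_anti hμ hi (le_of_lt hs)) (norm_nonneg _)

theorem setIntegral_norm_mul_tailWeight_le (hμ : 0 < μ) (hr : Continuous r)
    (hi : ∀ a, IntegrableOn r (Ioi a)) (x : ℝ) :
    ∫ s in Ioi x, ‖r s‖ * tailWeight μ r s ≤ tailWeight μ r x / μ := by
  have hd : ∀ y ∈ Ici x, HasDerivAt (fun y => -(tailWeight μ r y / μ))
      (‖r y‖ * tailWeight μ r y) y := fun y _ => by
    have h := (((hasDerivAt_setIntegral_Ioi hr.norm (fun a => (hi a).norm) y).const_mul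
      μ).exp.div_const μ).neg
    refine h.congr_deriv ?_
    rw [tailWeight]
    field_simp
  have ht : Tendsto (fun y => -(tailWeight μ r y / μ)) atTop (𝓝 (-(1 / μ))) := by
    have h0 := (tendsto_setIntegral_Ioi_zero (fun a => (hi a).norm)).const_mul μ
    have h1 := (Real.continuous_exp.tendsto _).comp h0
    simp only [mul_zero, Real.exp_zero] at h1
    exact (h1.div_const μ).neg
  rw [integral_Ioi_of_hasDerivAt_of_tendsto' hd
    (integrableOn_norm_mul_tailWeight hμ.le hr hi x) ht]
  have : 0 < 1 / μ := by positivity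
  linarith

end Weight

variable {E : Type*} [NormedAddCommGroup E] [NormedSpace ℂ E] {ν : ℂ} {P Q S : E →L[ℂ] E}
  {g : ℝ → E} {r : ℝ → ℂ} {μ : ℝ}

theorem norm_exp_neg_mul_ofReal (ν : ℂ) (s : ℝ) : ‖exp (-(ν * s))‖ = Real.exp (-(ν.re * s)) := by
  simp [norm_exp]

theorem integrableOn_exp_smul (hν : 0 ≤ ν.re) (hg : Continuous g)
    (hi : ∀ a, IntegrableOn g (Ioi a)) (a : ℝ) :
    IntegrableOn (fun s : ℝ => exp (-(ν * s)) • g s) (Ioi a) := by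
  refine Integrable.mono' ((hi a).norm.const_mul (Real.exp (-(ν.re * a))))
    (by fun_prop : Continuous fun s : ℝ => exp (-(ν * s)) • g s).aestronglyMeasurable ?_
  filter_upwards [ae_restrict_mem measurableSet_Ioi] with s hs
  rw [norm_smul, norm_exp_neg_mul_ofReal]
  have : ν.re * a ≤ ν.re * s := mul_le_mul_of_nonneg_left (le_of_lt hs) hν
  gcongr

theorem norm_smul_apply_le_mul_tailWeight {w : ℝ → E} {D : ℝ}
    (hw : ∀ s, ‖w s‖ ≤ D * tailWeight μ r s) (s : ℝ) :
    ‖r s • S (w s)‖ ≤ ‖S‖ * D * (‖r s‖ * tailWeight μ r s) := by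
  rw [norm_smul]
  calc ‖r s‖ * ‖S (w s)‖ ≤ ‖r s‖ * (‖S‖ * (D * tailWeight μ r s)) := by
        gcongr
        exact (S.le_opNorm _).trans (mul_le_mul_of_nonneg_left (hw s) (norm_nonneg _))
    _ = _ := by ring

theorem integrableOn_smul_apply (hμ : 0 ≤ μ) (hr : Continuous r)
    (hi : ∀ a, IntegrableOn r (Ioi a)) {w : ℝ → E} (hwc : Continuous w) {D : ℝ}
    (hw : ∀ s, ‖w s‖ ≤ D * tailWeight μ r s) (a : ℝ) :
    IntegrableOn (fun s => r s • S (w s)) (Ioi a) :=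
  Integrable.mono' ((integrableOn_norm_mul_tailWeight hμ hr hi a).const_mul (‖S‖ * D))
    (by fun_prop : Continuous fun s => r s • S (w s)).aestronglyMeasurable
    (ae_of_all _ (norm_smul_apply_le_mul_tailWeight hw))

variable [NormedSpace ℝ E]

/-- The integral `∫ s in Ioi x, (P + exp (ν * (x - s)) • Q) (g s)`. -/
noncomputable def volterraIoi (ν : ℂ) (P Q : E →L[ℂ] E) (g : ℝ → E) (x : ℝ) : E :=
  P (∫ s in Ioi x, g s) + exp (ν * x) • Q (∫ s in Ioi x, exp (-(ν * s)) • g s)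

theorem volterraIoi_sub (hν : 0 ≤ ν.re) {g₁ g₂ : ℝ → E} (h₁ : Continuous g₁) (h₂ : Continuous g₂)
    (hi₁ : ∀ a, IntegrableOn g₁ (Ioi a)) (hi₂ : ∀ a, IntegrableOn g₂ (Ioi a)) (x : ℝ) :
    volterraIoi ν P Q (fun s => g₁ s - g₂ s) x
      = volterraIoi ν P Q g₁ x - volterraIoi ν P Q g₂ x := by
  simp only [volterraIoi, smul_sub]
  rw [integral_sub (hi₁ x) (hi₂ x), integral_sub (integrableOn_exp_smul hν h₁ hi₁ x)
    (integrableOn_exp_smul hν h₂ hi₂ x)]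
  simp only [map_sub, smul_sub]
  abel

variable [IsScalarTower ℝ ℂ E]

theorem norm_volterraIoi_le (hν : 0 ≤ ν.re) (hi : ∀ a, IntegrableOn g (Ioi a)) (x : ℝ) :
    ‖volterraIoi ν P Q g x‖ ≤ (‖P‖ + ‖Q‖) * ∫ s in Ioi x, ‖g s‖ := by
  have h1 : ‖P (∫ s in Ioi x, g s)‖ ≤ ‖P‖ * ∫ s in Ioi x, ‖g s‖ :=
    (P.le_opNorm _).trans (mul_le_mul_of_nonneg_left (norm_integral_le_integral_norm _)
      (norm_nonneg _))
  have h2 : ‖exp (ν * x) • ∫ s in Ioi x, exp (-(ν * s)) • g s‖ ≤ ∫ s in Ioi x, ‖g s‖ := by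
    rw [← integral_smul]
    refine norm_integral_le_of_norm_le (hi x).norm ?_
    filter_upwards [ae_restrict_mem measurableSet_Ioi] with s hs
    have h3 : ν.re * x ≤ ν.re * s := mul_le_mul_of_nonneg_left (le_of_lt hs) hν
    rw [smul_smul, norm_smul, ← exp_add, norm_exp]
    refine mul_le_of_le_one_left (norm_nonneg _) (Real.exp_le_one_iff.2 ?_)
    simpa using h3
  have h4 : ‖exp (ν * x) • Q (∫ s in Ioi x, exp (-(ν * s)) • g s)‖
      ≤ ‖Q‖ * ∫ s in Ioi x, ‖g s‖ := by
    rw [← map_smul]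
    exact (Q.le_opNorm _).trans (mul_le_mul_of_nonneg_left h2 (norm_nonneg _))
  rw [add_mul]
  exact (norm_add_le _ _).trans (add_le_add h1 h4)

theorem norm_volterraIoi_smul_le (hν : 0 ≤ ν.re) (hμ : 0 < μ) (hr : Continuous r)
    (hi : ∀ a, IntegrableOn r (Ioi a)) {w : ℝ → E} (hwc : Continuous w) {D : ℝ} (hD : 0 ≤ D)
    (hw : ∀ s, ‖w s‖ ≤ D * tailWeight μ r s) (x : ℝ) :
    ‖volterraIoi ν P Q (fun s => r s • S (w s)) x‖
      ≤ (‖P‖ + ‖Q‖) * ‖S‖ / μ * D * tailWeight μ r x := by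
  have hint := integrableOn_smul_apply (S := S) hμ.le hr hi hwc hw
  have h : ∫ s in Ioi x, ‖r s • S (w s)‖ ≤ ‖S‖ * D * (tailWeight μ r x / μ) := by
    calc _ ≤ ∫ s in Ioi x, ‖S‖ * D * (‖r s‖ * tailWeight μ r s) :=
          integral_mono (hint x).norm
            ((integrableOn_norm_mul_tailWeight hμ.le hr hi x).const_mul _)
            (norm_smul_apply_le_mul_tailWeight hw)
      _ ≤ _ := by
          rw [integral_const_mul]
          exact mul_le_mul_of_nonneg_left (setIntegral_norm_mul_tailWeight_le hμ hr hi x)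
            (by positivity)
  calc _ ≤ (‖P‖ + ‖Q‖) * ∫ s in Ioi x, ‖r s • S (w s)‖ := norm_volterraIoi_le hν hint x
    _ ≤ (‖P‖ + ‖Q‖) * (‖S‖ * D * (tailWeight μ r x / μ)) := by gcongr
    _ = _ := by ring

variable [CompleteSpace E]

theorem hasDerivAt_volterraIoi (hν : 0 ≤ ν.re) (hg : Continuous g)
    (hi : ∀ a, IntegrableOn g (Ioi a)) (x : ℝ) :
    HasDerivAt (volterraIoi ν P Q g)
      (-(P (g x)) - Q (g x) +
        ν • exp (ν * x) • Q (∫ s in Ioi x, exp (-(ν * s)) • g s)) x := by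
  have h1 := (P.restrictScalars ℝ).hasFDerivAt.comp_hasDerivAt x
    (hasDerivAt_setIntegral_Ioi hg hi x)
  have h2 := (Q.restrictScalars ℝ).hasFDerivAt.comp_hasDerivAt x
    (hasDerivAt_setIntegral_Ioi (by fun_prop) (integrableOn_exp_smul hν hg hi) x)
  have h3 : HasDerivAt (fun y : ℝ => exp (ν * y)) (exp (ν * x) * ν) x := by
    simpa using (((hasDerivAt_id (x : ℂ)).const_mul ν).cexp).comp_ofReal
  refine (h1.add (h3.smul h2)).congr_deriv ?_
  simp only [Function.comp_apply, ContinuousLinearMap.coe_restrictScalars', map_neg, map_smul,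
    smul_neg, smul_smul, ← exp_add, add_neg_cancel, exp_zero, one_smul]
  rw [mul_comm (exp _) ν]
  abel

theorem exists_eq_sub_volterraIoi (hν : 0 ≤ ν.re) (hr : Continuous r)
    (hi : ∀ a, IntegrableOn r (Ioi a)) (P Q S : E →L[ℂ] E) (v : E) :
    ∃ w : ℝ → E, Continuous w ∧ (∀ a, IntegrableOn (fun s => r s • S (w s)) (Ioi a)) ∧
      ∀ x, w x = v - volterraIoi ν P Q (fun s => r s • S (w s)) x := by
  obtain ⟨μ, hμdef⟩ : ∃ μ : ℝ, μ = 2 * ((‖P‖ + ‖Q‖) * ‖S‖) + 1 := ⟨_, rfl⟩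
  have hμ : 0 < μ := by rw [hμdef]; positivity
  have hκ : (‖P‖ + ‖Q‖) * ‖S‖ / μ ≤ 1 / 2 := by
    rw [div_le_iff₀ hμ]; linarith
  let W : ℝ → ℝ := tailWeight μ r
  have hWc : Continuous W := continuous_tailWeight hr hi
  have hW : ∀ x, 0 < W x := tailWeight_pos
  have hlc : ∀ f : BoundedContinuousFunction ℝ E, Continuous fun s => W s • f s :=
    fun f => hWc.smul f.continuous
  have hlb : ∀ (f : BoundedContinuousFunction ℝ E) s, ‖W s • f s‖ ≤ ‖f‖ * W s := fun f s => by
    rw [norm_smul, Real.norm_of_nonneg (hW s).le, mul_comm]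
    exact mul_le_mul_of_nonneg_right (f.norm_coe_le_norm s) (hW s).le
  let J : BoundedContinuousFunction ℝ E → ℝ → E :=
    fun f => volterraIoi ν P Q fun s => r s • S (W s • f s)
  have hint : ∀ (f : BoundedContinuousFunction ℝ E) (a : ℝ),
      IntegrableOn (fun s => r s • S (W s • f s)) (Ioi a) := fun f =>
    integrableOn_smul_apply hμ.le hr hi (hlc f) (hlb f)
  have hgc : ∀ f : BoundedContinuousFunction ℝ E, Continuous fun s => r s • S (W s • f s) :=
    fun f => hr.smul (S.continuous.comp (hlc f))
  have hJc : ∀ f, Continuous (J f) := fun f => continuous_iff_continuousAt.2 fun x =>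
    (hasDerivAt_volterraIoi hν (hgc f) (hint f) x).continuousAt
  have hJb : ∀ f x, ‖J f x‖ ≤ 1 / 2 * ‖f‖ * W x := fun f x =>
    (norm_volterraIoi_smul_le hν hμ hr hi (hlc f) (norm_nonneg f) (hlb f) x).trans <|
      mul_le_mul_of_nonneg_right (mul_le_mul_of_nonneg_right hκ (norm_nonneg f)) (hW x).le
  have hJsub : ∀ f₁ f₂ x, J (f₁ - f₂) x = J f₁ x - J f₂ x := fun f₁ f₂ x => by
    rw [← volterraIoi_sub hν (hgc f₁) (hgc f₂) (hint f₁) (hint f₂)]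
    simp only [J, BoundedContinuousFunction.sub_apply, smul_sub, map_sub]
  let T : BoundedContinuousFunction ℝ E → BoundedContinuousFunction ℝ E := fun f =>
    BoundedContinuousFunction.ofNormedAddCommGroup (fun x => (W x)⁻¹ • (v - J f x))
      ((hWc.inv₀ fun x => (hW x).ne').smul (continuous_const.sub (hJc f)))
      (‖v‖ + 1 / 2 * ‖f‖) fun x => by
        rw [norm_smul, norm_inv, Real.norm_of_nonneg (hW x).le, inv_mul_le_iff₀ (hW x), mul_comm]
        have h1 : ‖v‖ * 1 ≤ ‖v‖ * W x :=
          mul_le_mul_of_nonneg_left (one_le_tailWeight hμ.le x) (norm_nonneg v)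
        linarith [norm_sub_le v (J f x), hJb f x]
  have hT : ContractingWith (1 / 2) T := by
    refine ⟨by norm_num, LipschitzWith.of_dist_le_mul fun f₁ f₂ => ?_⟩
    rw [BoundedContinuousFunction.dist_le (by positivity)]
    intro x
    change dist ((W x)⁻¹ • (v - J f₁ x)) ((W x)⁻¹ • (v - J f₂ x)) ≤ _
    rw [dist_eq_norm, ← smul_sub, sub_sub_sub_cancel_left, ← hJsub, norm_smul, norm_inv,
      Real.norm_of_nonneg (hW x).le, inv_mul_le_iff₀ (hW x), dist_comm, dist_eq_norm, mul_comm]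
    simpa using hJb (f₂ - f₁) x
  let f := hT.fixedPoint
  have hf : T f = f := hT.fixedPoint_isFixedPt
  refine ⟨fun s => W s • f s, hlc f, hint f, fun x => ?_⟩
  have hx : f x = (W x)⁻¹ • (v - J f x) := congrArg (fun φ => φ x) hf.symm
  change W x • f x = v - J f x
  rw [hx, smul_smul, mul_inv_cancel₀ (hW x).ne', one_smul]

/-- Jost solutions at `+∞` for a perturbed constant-coefficient linear system whose generator `B`
satisfies `B ^ 2 = ν • B`. -/
theorem exists_hasDerivAt_tendsto_atTop (hν : 0 ≤ ν.re) (hν0 : ν ≠ 0) (hr : Continuous r)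
    (hi : ∀ a, IntegrableOn r (Ioi a)) {B : E →L[ℂ] E} (S : E →L[ℂ] E)
    (hB : ∀ x, B (B x) = ν • B x) {v : E} (hv : B v = 0) :
    ∃ w : ℝ → E, (∀ x, HasDerivAt w (B (w x) + r x • S (w x)) x) ∧ Tendsto w atTop (𝓝 v) := by
  obtain ⟨w, hwc, hwi, hw⟩ := exists_eq_sub_volterraIoi hν hr hi
    (ContinuousLinearMap.id ℂ E - ν⁻¹ • B) (ν⁻¹ • B) S v
  have hgc : Continuous fun s => r s • S (w s) := by fun_prop
  refine ⟨w, fun x => ?_, ?_⟩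
  · have h := (hasDerivAt_volterraIoi (P := ContinuousLinearMap.id ℂ E - ν⁻¹ • B)
      (Q := ν⁻¹ • B) hν hgc hwi x).const_sub v
    rw [← funext hw] at h
    refine h.congr_deriv ?_
    have hBw : B (w x) = -(exp (ν * x) • B (∫ s in Ioi x, exp (-(ν * s)) • r s • S (w s))) := by
      rw [hw x]
      simp only [volterraIoi, sub_apply, smul_apply, ContinuousLinearMap.id_apply, map_sub,
        map_add, map_smul, hB, hv]
      match_scalars <;> field_simp <;> simp
    rw [hBw]
    simp only [sub_apply, smul_apply, ContinuousLinearMap.id_apply]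
    match_scalars <;> field_simp <;> simp
  · have h0 : Tendsto (volterraIoi ν (ContinuousLinearMap.id ℂ E - ν⁻¹ • B) (ν⁻¹ • B)
        fun s => r s • S (w s)) atTop (𝓝 0) := by
      refine squeeze_zero_norm (norm_volterraIoi_le hν hwi) ?_
      simpa using (tendsto_setIntegral_Ioi_zero fun a => (hwi a).norm).const_mul
        (‖ContinuousLinearMap.id ℂ E - ν⁻¹ • B‖ + ‖ν⁻¹ • B‖)
    rw [funext hw]
    simpa using h0.const_sub v

end VolterraIoi

section OffDiagonalSystem

variable {p : ℝ → ℂ} {α β θ a b : ℂ}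

theorem exists_jostAsymp_atTop (hp : Continuous p) (hi : ∀ t, IntegrableOn p (Ioi t))
    (hθ : θ.re ≤ 0) (hθ0 : θ ≠ 0) (ha : a ≠ 0) (hb : b ≠ 0)
    (h₁ : α * b = θ * a) (h₂ : β * a = θ * b) :
    ∃ u : ℝ → ℂ × ℂ,
      (∀ x, HasDerivAt (fun y => (u y).1) ((α + p x) * (u x).2) x) ∧
      (∀ x, HasDerivAt (fun y => (u y).2) ((β + p x) * (u x).1) x) ∧
      JostAsymp u θ (a, b) atTop := by
  have hsq : α * β = θ ^ 2 := mul_right_cancel₀ (mul_ne_zero ha hb)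
    (by linear_combination β * a * h₁ + θ * a * h₂)
  let B : ℂ × ℂ →L[ℂ] ℂ × ℂ :=
    (α • ContinuousLinearMap.snd ℂ ℂ ℂ - θ • ContinuousLinearMap.fst ℂ ℂ ℂ).prod
      (β • ContinuousLinearMap.fst ℂ ℂ ℂ - θ • ContinuousLinearMap.snd ℂ ℂ ℂ)
  let S : ℂ × ℂ →L[ℂ] ℂ × ℂ :=
    (ContinuousLinearMap.snd ℂ ℂ ℂ).prod (ContinuousLinearMap.fst ℂ ℂ ℂ)
  have hB : ∀ x, B x = (α * x.2 - θ * x.1, β * x.1 - θ * x.2) := fun x => rfl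
  have hS : ∀ x, S x = (x.2, x.1) := fun x => rfl
  obtain ⟨w, hw, hlim⟩ := exists_hasDerivAt_tendsto_atTop (ν := -2 * θ) (r := p) (B := B)
    (v := (a, b)) (by simp; linarith) (by simpa using hθ0) hp hi S
    (fun x => by
      ext
      · simp only [hB, Prod.smul_mk, smul_eq_mul]
        linear_combination x.1 * hsq
      · simp only [hB, Prod.smul_mk, smul_eq_mul]
        linear_combination x.2 * hsq)
    (by simp [hB, h₁, h₂])
  have he : ∀ x : ℝ, HasDerivAt (fun y : ℝ => exp (θ * y)) (exp (θ * x) * θ) x := fun x => by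
    simpa using (((hasDerivAt_id (x : ℂ)).const_mul θ).cexp).comp_ofReal
  have hexp : ∀ (x : ℝ) (z : ℂ), exp (θ * x) * z * exp (-(θ * x)) = z := fun x z => by
    rw [mul_right_comm, ← exp_add, add_neg_cancel, exp_zero, one_mul]
  refine ⟨fun x => (exp (θ * x) * (w x).1, exp (θ * x) * (w x).2), fun x => ?_, fun x => ?_, ?_⟩
  · have h := (ContinuousLinearMap.fst ℝ ℂ ℂ).hasFDerivAt.comp_hasDerivAt x (hw x)
    refine ((he x).mul h).congr_deriv ?_
    simp [hB, hS]
    ring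
  · have h := (ContinuousLinearMap.snd ℝ ℂ ℂ).hasFDerivAt.comp_hasDerivAt x (hw x)
    refine ((he x).mul h).congr_deriv ?_
    simp [hB, hS]
    ring
  · simp only [JostAsymp, hexp]
    exact ⟨(continuous_fst.tendsto _).comp hlim, (continuous_snd.tendsto _).comp hlim⟩

theorem exists_jostAsymp_atBot (hp : Continuous p) (hi : ∀ t, IntegrableOn p (Iio t))
    (hθ : 0 ≤ θ.re) (hθ0 : θ ≠ 0) (ha : a ≠ 0) (hb : b ≠ 0)
    (h₁ : α * b = θ * a) (h₂ : β * a = θ * b) :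
    ∃ u : ℝ → ℂ × ℂ,
      (∀ x, HasDerivAt (fun y => (u y).1) ((α + p x) * (u x).2) x) ∧
      (∀ x, HasDerivAt (fun y => (u y).2) ((β + p x) * (u x).1) x) ∧
      JostAsymp u θ (a, b) atBot := by
  obtain ⟨u, hu₁, hu₂, hl₁, hl₂⟩ := exists_jostAsymp_atTop (p := fun x => -p (-x)) (α := -α)
    (β := -β) (θ := -θ) (a := a) (b := b) (by fun_prop)
    (fun t => (IntegrableOn.comp_neg_Ioi (hi (-t))).neg) (by simpa using hθ) (by simpa using hθ0)
    ha hb (by linear_combination -h₁) (by linear_combination -h₂)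
  refine ⟨fun x => u (-x), fun x => ?_, fun x => ?_, ?_, ?_⟩
  · refine ((hu₁ (-x)).scomp x (hasDerivAt_neg x)).congr_deriv ?_
    simp
    ring
  · refine ((hu₂ (-x)).scomp x (hasDerivAt_neg x)).congr_deriv ?_
    simp
    ring
  · refine (hl₁.comp tendsto_neg_atBot_atTop).congr fun x => ?_
    simp
  · refine (hl₂.comp tendsto_neg_atBot_atTop).congr fun x => ?_
    simp

end OffDiagonalSystem

section Dirac

variable {hp m c E W : ℝ} {V : ℂ → ℂ} {θ a b : ℂ}

theorem isDiracSolution_of_hasDerivAt (hhp : 0 < hp) (hc : 0 < c) {u : ℝ → ℂ × ℂ}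
    (h₁ : ∀ x : ℝ, HasDerivAt (fun y => (u y).1)
      ((I / (hp * c) * (E - W + m * c ^ 2) + I / (hp * c) * (W - V x)) * (u x).2) x)
    (h₂ : ∀ x : ℝ, HasDerivAt (fun y => (u y).2)
      ((I / (hp * c) * (E - W - m * c ^ 2) + I / (hp * c) * (W - V x)) * (u x).1) x) :
    IsDiracSolution hp m c V E u := by
  have hp0 : (hp : ℂ) ≠ 0 := by exact_mod_cast hhp.ne'
  have hc0 : (c : ℂ) ≠ 0 := by exact_mod_cast hc.ne'
  refine ⟨fun x => (h₁ x).differentiableAt, fun x => (h₂ x).differentiableAt, fun x => ?_,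
    fun x => ?_⟩
  · rw [(h₂ x).deriv]
    field_simp
    rw [I_sq]
    ring
  · rw [(h₁ x).deriv]
    field_simp
    rw [I_sq]
    ring

theorem exists_isDiracSolution_jostAsymp_atTop (hhp : 0 < hp) (hc : 0 < c)
    (hV : Continuous fun x : ℝ => V x) (hi : ∀ t, IntegrableOn (fun x : ℝ => V x - W) (Ioi t))
    (hθ : θ.re ≤ 0) (hθ0 : θ ≠ 0) (ha : a ≠ 0) (hb : b ≠ 0)
    (h₁ : I / (hp * c) * (E - W + m * c ^ 2) * b = θ * a)
    (h₂ : I / (hp * c) * (E - W - m * c ^ 2) * a = θ * b) :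
    ∃ u, IsDiracSolution hp m c V E u ∧ JostAsymp u θ (a, b) atTop := by
  obtain ⟨u, hu₁, hu₂, hu⟩ := exists_jostAsymp_atTop
    (p := fun x : ℝ => I / (hp * c) * (W - V x))
    (continuous_const.mul (continuous_const.sub hV))
    (fun t => by simpa [IntegrableOn] using (hi t).neg.const_mul (I / (hp * c))) hθ hθ0
    ha hb h₁ h₂
  exact ⟨u, isDiracSolution_of_hasDerivAt hhp hc hu₁ hu₂, hu⟩

theorem exists_isDiracSolution_jostAsymp_atBot (hhp : 0 < hp) (hc : 0 < c)
    (hV : Continuous fun x : ℝ => V x) (hi : ∀ t, IntegrableOn (fun x : ℝ => V x - W) (Iio t))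
    (hθ : 0 ≤ θ.re) (hθ0 : θ ≠ 0) (ha : a ≠ 0) (hb : b ≠ 0)
    (h₁ : I / (hp * c) * (E - W + m * c ^ 2) * b = θ * a)
    (h₂ : I / (hp * c) * (E - W - m * c ^ 2) * a = θ * b) :
    ∃ u, IsDiracSolution hp m c V E u ∧ JostAsymp u θ (a, b) atBot := by
  obtain ⟨u, hu₁, hu₂, hu⟩ := exists_jostAsymp_atBot
    (p := fun x : ℝ => I / (hp * c) * (W - V x))
    (continuous_const.mul (continuous_const.sub hV))
    (fun t => by simpa [IntegrableOn] using (hi t).neg.const_mul (I / (hp * c))) hθ hθ0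
    ha hb h₁ h₂
  exact ⟨u, isDiracSolution_of_hasDerivAt hhp hc hu₁ hu₂, hu⟩

end Dirac

section Amplitude

variable {m c l : ℝ}

theorem ampF_pos (h : 0 < (l + m * c ^ 2) / (l - m * c ^ 2)) : 0 < AmpF m c l :=
  Real.rpow_pos_of_pos h _

theorem rpow_quarter_pow_four {x : ℝ} (hx : 0 ≤ x) : (x ^ ((1 : ℝ) / 4)) ^ 4 = x := by
  rw [← Real.rpow_natCast, ← Real.rpow_mul hx]
  norm_num

theorem phiF_ne_zero (hm : 0 < m) (hc : 0 < c) (hl : m * c ^ 2 < |l|) : PhiF m c l ≠ 0 := by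
  have hM : 0 < m * c ^ 2 := by positivity
  have h : (m * c ^ 2) ^ 2 < l ^ 2 := by rw [← sq_abs l]; gcongr
  refine mul_ne_zero ?_ (Real.sqrt_pos.2 (by nlinarith)).ne'
  rw [Ne, Real.sign_eq_zero_iff]
  rintro rfl
  simp at hl
  linarith

theorem div_pos_of_lt_abs (hm : 0 < m) (hc : 0 < c) (hl : m * c ^ 2 < |l|) :
    0 < (l + m * c ^ 2) / (l - m * c ^ 2) := by
  have hM : 0 < m * c ^ 2 := by positivity
  rcases lt_abs.1 hl with h | h
  · exact div_pos (by linarith) (by linarith)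
  · exact div_pos_of_neg_of_neg (by linarith) (by linarith)

theorem phiF_mul_ampF_sq (hm : 0 < m) (hc : 0 < c) (hl : m * c ^ 2 < |l|) :
    PhiF m c l * AmpF m c l ^ 2 = l + m * c ^ 2 := by
  have hM : 0 < m * c ^ 2 := by positivity
  have hX := div_pos_of_lt_abs hm hc hl
  have hA : AmpF m c l ^ 4 = (l + m * c ^ 2) / (l - m * c ^ 2) := rpow_quarter_pow_four hX.le
  have hne : l - m * c ^ 2 ≠ 0 := fun h => by simp [h] at hX
  have h0 : 0 ≤ l ^ 2 - m ^ 2 * c ^ 4 := by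
    have h : (m * c ^ 2) ^ 2 < l ^ 2 := by rw [← sq_abs l]; gcongr
    nlinarith
  have hsq : (√(l ^ 2 - m ^ 2 * c ^ 4) * AmpF m c l ^ 2) ^ 2 = (l + m * c ^ 2) ^ 2 := by
    rw [mul_pow, Real.sq_sqrt h0, ← pow_mul, hA]
    field_simp
    ring
  have hnn : 0 ≤ √(l ^ 2 - m ^ 2 * c ^ 4) * AmpF m c l ^ 2 := by positivity
  rcases lt_abs.1 hl with h | h
  · rw [PhiF, Real.sign_of_pos (by linarith), one_mul]
    exact (sq_eq_sq₀ hnn (by linarith)).1 hsq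
  · rw [PhiF, Real.sign_of_neg (by linarith), mul_assoc]
    rw [← neg_sq (l + m * c ^ 2)] at hsq
    linarith [(sq_eq_sq₀ hnn (by linarith : 0 ≤ -(l + m * c ^ 2))).1 hsq]

theorem phiF_eq (hm : 0 < m) (hc : 0 < c) (hl : m * c ^ 2 < |l|) :
    PhiF m c l = (l - m * c ^ 2) * AmpF m c l ^ 2 := by
  have hX := div_pos_of_lt_abs hm hc hl
  have hA : AmpF m c l ^ 4 = (l + m * c ^ 2) / (l - m * c ^ 2) := rpow_quarter_pow_four hX.le
  have hne : l - m * c ^ 2 ≠ 0 := fun h => by simp [h] at hX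
  have h2 : AmpF m c l ^ 2 ≠ 0 := by have := ampF_pos hX; positivity
  rw [eq_div_iff hne] at hA
  refine mul_right_cancel₀ h2 ?_
  rw [phiF_mul_ampF_sq hm hc hl]
  linear_combination -hA

end Amplitude

section EvanescentAmplitude

variable {m c E W : ℝ}

theorem bsym_pos (h : |E - W| < m * c ^ 2) : 0 < Bsym m c E W := by
  have := abs_lt.1 h
  exact Real.rpow_pos_of_pos (div_pos (by linarith) (by linarith)) _

theorem sub_sq_pos_of_abs_lt (h : |E - W| < m * c ^ 2) : 0 < m ^ 2 * c ^ 4 - (W - E) ^ 2 := by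
  have := abs_lt.1 h
  have h' := mul_pos (by linarith : 0 < m * c ^ 2 - (E - W)) (by linarith : 0 < m * c ^ 2 + (E - W))
  linarith

theorem sqrt_mul_bsym_sq (h : |E - W| < m * c ^ 2) :
    √(m ^ 2 * c ^ 4 - (W - E) ^ 2) * Bsym m c E W ^ 2 = E - W + m * c ^ 2 := by
  have h' := abs_lt.1 h
  have h₁ : 0 < m * c ^ 2 - E + W := by linarith
  have h₂ : 0 < m * c ^ 2 + E - W := by linarith
  have hB : Bsym m c E W ^ 4 = (m * c ^ 2 + E - W) / (m * c ^ 2 - E + W) :=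
    rpow_quarter_pow_four (div_pos h₂ h₁).le
  refine (sq_eq_sq₀ (by positivity) (by linarith)).1 ?_
  rw [mul_pow, Real.sq_sqrt (sub_sq_pos_of_abs_lt h).le, ← pow_mul, hB]
  field_simp
  ring

theorem sqrt_eq_mul_bsym_sq (h : |E - W| < m * c ^ 2) :
    √(m ^ 2 * c ^ 4 - (W - E) ^ 2) = -(E - W - m * c ^ 2) * Bsym m c E W ^ 2 := by
  have h' := abs_lt.1 h
  have h₁ : 0 < m * c ^ 2 - E + W := by linarith
  have h₂ : 0 < m * c ^ 2 + E - W := by linarith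
  have hB : Bsym m c E W ^ 4 = (m * c ^ 2 + E - W) / (m * c ^ 2 - E + W) :=
    rpow_quarter_pow_four (div_pos h₂ h₁).le
  rw [eq_div_iff h₁.ne'] at hB
  refine mul_right_cancel₀ (pow_pos (bsym_pos h) 2).ne' ?_
  rw [sqrt_mul_bsym_sq h]
  linear_combination -hB

end EvanescentAmplitude

section Relations

variable {hp m c E W s : ℝ}

theorem jost_relation_fst (hm : 0 < m) (hc : 0 < c) (hl : m * c ^ 2 < |E - W|) :
    I / (hp * c) * (E - W + m * c ^ 2) * ((s : ℂ) * ((AmpF m c (E - W) : ℝ) : ℂ)⁻¹)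
      = (s : ℂ) * I / (hp * c) * (PhiF m c (E - W) : ℝ) * (AmpF m c (E - W) : ℝ) := by
  have hA : ((AmpF m c (E - W) : ℝ) : ℂ) ≠ 0 := by
    exact_mod_cast (ampF_pos (div_pos_of_lt_abs hm hc hl)).ne'
  have h : ((PhiF m c (E - W) : ℝ) : ℂ) * ((AmpF m c (E - W) : ℝ) : ℂ) ^ 2
      = E - W + m * c ^ 2 := by exact_mod_cast phiF_mul_ampF_sq hm hc hl
  rw [← h]
  field_simp

theorem jost_relation_snd (hm : 0 < m) (hc : 0 < c) (hl : m * c ^ 2 < |E - W|)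
    (hs : s ^ 2 = 1) :
    I / (hp * c) * (E - W - m * c ^ 2) * (AmpF m c (E - W) : ℝ)
      = (s : ℂ) * I / (hp * c) * (PhiF m c (E - W) : ℝ)
        * ((s : ℂ) * ((AmpF m c (E - W) : ℝ) : ℂ)⁻¹) := by
  have hA : ((AmpF m c (E - W) : ℝ) : ℂ) ≠ 0 := by
    exact_mod_cast (ampF_pos (div_pos_of_lt_abs hm hc hl)).ne'
  have h : ((PhiF m c (E - W) : ℝ) : ℂ)
      = (E - W - m * c ^ 2) * ((AmpF m c (E - W) : ℝ) : ℂ) ^ 2 := by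
    exact_mod_cast phiF_eq hm hc hl
  have hs' : (s : ℂ) ^ 2 = 1 := by exact_mod_cast hs
  rw [h]
  field_simp
  rw [hs']
  ring

theorem decay_relation_fst (hl : |E - W| < m * c ^ 2)
    (hs : s ^ 2 = 1) :
    I / (hp * c) * (E - W + m * c ^ 2) * ((Bsym m c E W : ℝ) : ℂ)⁻¹
      = -(s : ℂ) * (√(m ^ 2 * c ^ 4 - (W - E) ^ 2) : ℝ) / (hp * c)
        * (-(s : ℂ) * I * (Bsym m c E W : ℝ)) := by
  have hB : ((Bsym m c E W : ℝ) : ℂ) ≠ 0 := by exact_mod_cast (bsym_pos hl).ne'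
  have h : ((√(m ^ 2 * c ^ 4 - (W - E) ^ 2) : ℝ) : ℂ) * ((Bsym m c E W : ℝ) : ℂ) ^ 2
      = E - W + m * c ^ 2 := by exact_mod_cast sqrt_mul_bsym_sq hl
  have hs' : (s : ℂ) ^ 2 = 1 := by exact_mod_cast hs
  rw [← h]
  field_simp
  rw [hs']
  ring

theorem decay_relation_snd (hl : |E - W| < m * c ^ 2) :
    I / (hp * c) * (E - W - m * c ^ 2) * (-(s : ℂ) * I * (Bsym m c E W : ℝ))
      = -(s : ℂ) * (√(m ^ 2 * c ^ 4 - (W - E) ^ 2) : ℝ) / (hp * c)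
        * ((Bsym m c E W : ℝ) : ℂ)⁻¹ := by
  have hB : ((Bsym m c E W : ℝ) : ℂ) ≠ 0 := by exact_mod_cast (bsym_pos hl).ne'
  have h : ((√(m ^ 2 * c ^ 4 - (W - E) ^ 2) : ℝ) : ℂ)
      = -(E - W - m * c ^ 2) * ((Bsym m c E W : ℝ) : ℂ) ^ 2 := by
    exact_mod_cast sqrt_eq_mul_bsym_sq hl
  rw [h]
  field_simp
  rw [I_sq]
  ring

end Relations

section JostSolutions

variable {hp m c E W s : ℝ} {V : ℂ → ℂ}

theorem jost_exponent_re :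
    ((s : ℂ) * I / (hp * c) * (PhiF m c (E - W) : ℝ)).re = 0 := by
  have h : (s : ℂ) * I / (hp * c) * (PhiF m c (E - W) : ℝ)
      = ((s / (hp * c) * PhiF m c (E - W) : ℝ) : ℂ) * I := by push_cast; ring
  rw [h, re_ofReal_mul, I_re, mul_zero]

theorem jost_exponent_ne_zero (hm : 0 < m) (hhp : 0 < hp) (hc : 0 < c)
    (hl : m * c ^ 2 < |E - W|) (hs : s ^ 2 = 1) :
    (s : ℂ) * I / (hp * c) * (PhiF m c (E - W) : ℝ) ≠ 0 := by
  have hs0 : s ≠ 0 := by rintro rfl; norm_num at hs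
  have hΦ := phiF_ne_zero hm hc hl
  simp [hs0, hΦ, hhp.ne', hc.ne', I_ne_zero]

theorem jost_amplitudes_ne_zero (hm : 0 < m) (hc : 0 < c) (hl : m * c ^ 2 < |E - W|)
    (hs : s ^ 2 = 1) :
    ((AmpF m c (E - W) : ℝ) : ℂ) ≠ 0 ∧ (s : ℂ) * ((AmpF m c (E - W) : ℝ) : ℂ)⁻¹ ≠ 0 := by
  have hs0 : s ≠ 0 := by rintro rfl; norm_num at hs
  have hA := (ampF_pos (div_pos_of_lt_abs hm hc hl)).ne'
  simp [hs0, hA]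

theorem exists_jostCond_atTop (hm : 0 < m) (hhp : 0 < hp) (hc : 0 < c)
    (hV : Continuous fun x : ℝ => V x) (hi : ∀ t, IntegrableOn (fun x : ℝ => V x - W) (Ioi t))
    (hl : m * c ^ 2 < |E - W|) (hs : s ^ 2 = 1) :
    ∃ u, IsDiracSolution hp m c V E u ∧ JostCond hp m c E W s s atTop u :=
  have ⟨ha, hb⟩ := jost_amplitudes_ne_zero hm hc hl hs
  exists_isDiracSolution_jostAsymp_atTop hhp hc hV hi jost_exponent_re.le
    (jost_exponent_ne_zero hm hhp hc hl hs) ha hb (jost_relation_fst hm hc hl)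
    (jost_relation_snd hm hc hl hs)

theorem exists_jostCond_atBot (hm : 0 < m) (hhp : 0 < hp) (hc : 0 < c)
    (hV : Continuous fun x : ℝ => V x) (hi : ∀ t, IntegrableOn (fun x : ℝ => V x - W) (Iio t))
    (hl : m * c ^ 2 < |E - W|) (hs : s ^ 2 = 1) :
    ∃ u, IsDiracSolution hp m c V E u ∧ JostCond hp m c E W s s atBot u :=
  have ⟨ha, hb⟩ := jost_amplitudes_ne_zero hm hc hl hs
  exists_isDiracSolution_jostAsymp_atBot hhp hc hV hi jost_exponent_re.ge
    (jost_exponent_ne_zero hm hhp hc hl hs) ha hb (jost_relation_fst hm hc hl)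
    (jost_relation_snd hm hc hl hs)

theorem decay_exponent_eq_ofReal :
    -(s : ℂ) * (√(m ^ 2 * c ^ 4 - (W - E) ^ 2) : ℝ) / (hp * c)
      = ((-s * √(m ^ 2 * c ^ 4 - (W - E) ^ 2) / (hp * c) : ℝ) : ℂ) := by
  push_cast; rfl

theorem exists_decayCond_atTop (hhp : 0 < hp) (hc : 0 < c)
    (hV : Continuous fun x : ℝ => V x) (hi : ∀ t, IntegrableOn (fun x : ℝ => V x - W) (Ioi t))
    (hl : |E - W| < m * c ^ 2) :
    ∃ u, IsDiracSolution hp m c V E u ∧ DecayCond hp m c E W 1 atTop u := by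
  have hk := Real.sqrt_pos.2 (sub_sq_pos_of_abs_lt hl)
  have hB := (bsym_pos hl).ne'
  refine exists_isDiracSolution_jostAsymp_atTop hhp hc hV hi ?_ ?_ ?_ ?_
    (decay_relation_fst hl (by norm_num)) (decay_relation_snd hl)
  · rw [decay_exponent_eq_ofReal, ofReal_re]
    exact div_nonpos_of_nonpos_of_nonneg (by linarith) (by positivity)
  · simp [hk.ne', hhp.ne', hc.ne']
  · simp [hB]
  · simp [hB]

theorem exists_decayCond_atBot (hhp : 0 < hp) (hc : 0 < c)
    (hV : Continuous fun x : ℝ => V x) (hi : ∀ t, IntegrableOn (fun x : ℝ => V x - W) (Iio t))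
    (hl : |E - W| < m * c ^ 2) :
    ∃ u, IsDiracSolution hp m c V E u ∧ DecayCond hp m c E W (-1) atBot u := by
  have hk := Real.sqrt_pos.2 (sub_sq_pos_of_abs_lt hl)
  have hB := (bsym_pos hl).ne'
  refine exists_isDiracSolution_jostAsymp_atBot hhp hc hV hi ?_ ?_ ?_ ?_
    (decay_relation_fst hl (by norm_num)) (decay_relation_snd hl)
  · rw [decay_exponent_eq_ofReal, ofReal_re]
    exact div_nonneg (by linarith) (by positivity)
  · simp [hk.ne', hhp.ne', hc.ne']
  · simp [hB]
  · simp [hB]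

end JostSolutions

section Potential

theorem ofReal_mem_sector {ε η : ℝ} (hε : 0 < ε) (hη : 0 < η) (x : ℝ) :
    (x : ℂ) ∈ Sector ε η := by
  simp only [Sector, mem_ofPred_eq, ofReal_im, abs_zero]
  positivity

theorem integrable_rpow_one_add_norm_ofReal_sq {δ : ℝ} (hδ : 1 < δ) :
    Integrable fun x : ℝ => (1 + ‖(x : ℂ)‖ ^ 2) ^ (-(δ / 2)) := by
  simpa [neg_div] using integrable_rpow_neg_one_add_norm_sq (E := ℝ) (μ := volume) (r := δ)
    (by simpa using hδ)

variable {V : ℂ → ℂ} {Vm Vp : ℝ}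

theorem AssumptionA.continuous (hA : AssumptionA V Vm Vp) : Continuous fun x : ℝ => V x := by
  obtain ⟨ε, hε, η, hη, δ, -, hV, -⟩ := hA.sector
  exact continuous_iff_continuousAt.2 fun x => ContinuousAt.comp (f := ((↑) : ℝ → ℂ))
    (hV x (ofReal_mem_sector hε hη x)).continuousAt continuous_ofReal.continuousAt

theorem AssumptionA.integrableOn_Ioi (hA : AssumptionA V Vm Vp) (t : ℝ) :
    IntegrableOn (fun x : ℝ => V x - Vp) (Ioi t) := by
  have hc : Continuous fun x : ℝ => V x - Vp := hA.continuous.sub continuous_const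
  obtain ⟨ε, hε, η, hη, δ, hδ, -, ⟨C, R, hCR⟩, -⟩ := hA.sector
  have hR : IntegrableOn (fun x : ℝ => V x - Vp) (Ioi R) := by
    refine Integrable.mono' ((integrable_rpow_one_add_norm_ofReal_sq hδ).const_mul C).integrableOn
      hc.aestronglyMeasurable ?_
    filter_upwards [ae_restrict_mem measurableSet_Ioi] with x hx
    exact hCR x (ofReal_mem_sector hε hη x) (by simpa using le_of_lt hx)
  refine ((hc.integrableOn_Icc (a := t) (b := R)).union hR).mono_set fun x hx => ?_
  rcases le_or_gt x R with h | h
  exacts [Or.inl ⟨le_of_lt hx, h⟩, Or.inr h]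

theorem AssumptionA.integrableOn_Iio (hA : AssumptionA V Vm Vp) (t : ℝ) :
    IntegrableOn (fun x : ℝ => V x - Vm) (Iio t) := by
  have hc : Continuous fun x : ℝ => V x - Vm := hA.continuous.sub continuous_const
  obtain ⟨ε, hε, η, hη, δ, hδ, -, -, ⟨C, R, hCR⟩⟩ := hA.sector
  have hR : IntegrableOn (fun x : ℝ => V x - Vm) (Iio (-R)) := by
    refine Integrable.mono' ((integrable_rpow_one_add_norm_ofReal_sq hδ).const_mul C).integrableOn
      hc.aestronglyMeasurable ?_
    filter_upwards [ae_restrict_mem measurableSet_Iio] with x hx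
    exact hCR x (ofReal_mem_sector hε hη x) (by simpa using le_of_lt hx)
  refine ((hc.integrableOn_Icc (a := -R) (b := t)).union hR).mono_set fun x hx => ?_
  rcases le_or_gt (-R) x with h | h
  exacts [Or.inl ⟨h, le_of_lt hx⟩, Or.inr h]

end Potential

/-- **Existence of Jost solutions, evanescent case** (Theorem 4.2, part 2).
Under assumption (A) and `m > 0`: for `E` in region II there are two Jost
solutions `ω_in^−, ω_out^−` (oscillatory at `−∞`) and a decaying solution
`ω_d^+` at `+∞`; for `E` in region IV there are two Jost solutions
`ω_in^+, ω_out^+` (oscillatory at `+∞`) and a decaying solution `ω_d^−` at `−∞`,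
with `ω_d^± ~ exp(∓(1/(hc))√(m²c⁴−(V^±−E)²) x)(∓i B^±, (B^±)⁻¹)` as `x → ±∞`. -/
theorem jost_solutions_evanescent
    (m c Vm Vp E : ℝ) (V : ℂ → ℂ)
    (hA : AssumptionA V Vm Vp) (hm : 0 < m) (hc : 0 < c) :
    (max (m * c ^ 2 + Vm) (Vp - m * c ^ 2) < E ∧ E < Vp + m * c ^ 2 →
      ∀ h : ℝ, 0 < h →
        ∃ ωinm ωoutm ωdp : ℝ → ℂ × ℂ,
          IsDiracSolution h m c V E ωinm ∧ IsDiracSolution h m c V E ωoutm ∧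
          IsDiracSolution h m c V E ωdp ∧
          JostCond h m c E Vm 1 1 atBot ωinm ∧
          JostCond h m c E Vm (-1) (-1) atBot ωoutm ∧
          DecayCond h m c E Vp 1 atTop ωdp) ∧
    (Vm - m * c ^ 2 < E ∧ E < min (Vm + m * c ^ 2) (Vp - m * c ^ 2) →
      ∀ h : ℝ, 0 < h →
        ∃ ωinp ωoutp ωdm : ℝ → ℂ × ℂ,
          IsDiracSolution h m c V E ωinp ∧ IsDiracSolution h m c V E ωoutp ∧
          IsDiracSolution h m c V E ωdm ∧
          JostCond h m c E Vp (-1) (-1) atTop ωinp ∧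
          JostCond h m c E Vp 1 1 atTop ωoutp ∧
          DecayCond h m c E Vm (-1) atBot ωdm) := by
  constructor
  · rintro ⟨hE₁, hE₂⟩ h hh
    obtain ⟨h₁, h₂⟩ := max_lt_iff.1 hE₁
    have hm' : m * c ^ 2 < |E - Vm| := lt_abs.2 (Or.inl (by linarith))
    have hp' : |E - Vp| < m * c ^ 2 := abs_lt.2 ⟨by linarith, by linarith⟩
    obtain ⟨u₁, hu₁, hj₁⟩ := exists_jostCond_atBot (s := 1) hm hh hc hA.continuous
      hA.integrableOn_Iio hm' (by norm_num)
    obtain ⟨u₂, hu₂, hj₂⟩ := exists_jostCond_atBot (s := -1) hm hh hc hA.continuous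
      hA.integrableOn_Iio hm' (by norm_num)
    obtain ⟨u₃, hu₃, hj₃⟩ := exists_decayCond_atTop hh hc hA.continuous hA.integrableOn_Ioi hp'
    exact ⟨u₁, u₂, u₃, hu₁, hu₂, hu₃, hj₁, hj₂, hj₃⟩
  · rintro ⟨hE₁, hE₂⟩ h hh
    obtain ⟨h₁, h₂⟩ := lt_min_iff.1 hE₂
    have hp' : m * c ^ 2 < |E - Vp| := lt_abs.2 (Or.inr (by linarith))
    have hm' : |E - Vm| < m * c ^ 2 := abs_lt.2 ⟨by linarith, by linarith⟩
    obtain ⟨u₁, hu₁, hj₁⟩ := exists_jostCond_atTop (s := -1) hm hh hc hA.continuous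
      hA.integrableOn_Ioi hp' (by norm_num)
    obtain ⟨u₂, hu₂, hj₂⟩ := exists_jostCond_atTop (s := 1) hm hh hc hA.continuous
      hA.integrableOn_Ioi hp' (by norm_num)
    obtain ⟨u₃, hu₃, hj₃⟩ := exists_decayCond_atBot hh hc hA.continuous hA.integrableOn_Iio hm'
    exact ⟨u₁, u₂, u₃, hu₁, hu₂, hu₃, hj₁, hj₂, hj₃⟩
end

section
/- Wronskian formula for WKB solutions with equal exponent signs (Lemma 3.8, first part): Let x₀, y₀ ∈ Ω(E) and let x̃, ỹ be amplitude base points with Ω_±(x̃) ∩ Ω_±(ỹ) ≠ ∅. Then for every x ∈ Ω_±(x̃) ∩ Ω_±(ỹ): W(u_±(x; x₀, x̃), u_±(x; y₀, ỹ)) = ±2i·exp(±(1/h)(z(x; x₀) + z(x; y₀)))·(w_±^odd(x; x₀, x̃)·w_±^even(x; y₀, ỹ) − w_±^even(x; x₀, x̃)·w_±^odd(x; y₀, ỹ)). -/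
open Complex Filter Topology Set

noncomputable section

/-- The canonical set `Ω_±(x̃)`: points `x ∈ Ω` reachable from the amplitude
base point by a path in the `z`-plane along which `±Re z` strictly increases. -/
def OmegaPM (Ω : Set ℂ) (z : ℂ → ℂ) (s : ℝ) (xt : ℂ) : Set ℂ :=
  {x ∈ Ω | ∃ γ : ℝ → ℂ, ContinuousOn γ (Set.Icc 0 1) ∧ γ 0 = z xt ∧ γ 1 = z x ∧
    (∀ t ∈ Set.Icc (0:ℝ) 1, γ t ∈ z '' Ω) ∧
    StrictMonoOn (fun t : ℝ => s * (γ t).re) (Set.Icc 0 1)}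

/-- The complex WKB solution `u_±(x; x₀, x̃)` of sign `s = ±1`, with phase
`z₁ = z(·; x₀)`, quartic-root amplitude `H`, and even/odd amplitude symbols
`wE`, `wO`:  `u_s = e^{s z₁/h} T_s(H) (wE, wO)ᵀ` with
`T_s = [[-s i H, s i H], [H⁻¹, H⁻¹]]`. -/
def WKBsol (hp : ℝ) (s : ℝ) (z₁ Hf wE wO : ℂ → ℂ) (x : ℂ) : ℂ × ℂ :=
  (Complex.exp ((s : ℂ) * z₁ x / (hp : ℂ)) *
      (-(s : ℂ) * Complex.I * Hf x * wE x + (s : ℂ) * Complex.I * Hf x * wO x),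
   Complex.exp ((s : ℂ) * z₁ x / (hp : ℂ)) *
      ((Hf x)⁻¹ * wE x + (Hf x)⁻¹ * wO x))

end

noncomputable section

/-- **Wronskian formula for complex WKB solutions with equal exponent signs**
(Lemma 3.8, first part).  With `g_± = (−mc² ∓ (V−E))/c`, `p² = g₊g₋`,
`H⁴ = g₋/g₊`, phases `z₁ = z(·;x₀)`, `z₂ = z(·;y₀)` (primitives of `p`
vanishing at the phase base points `x₀, y₀ ∈ Ω(E)`), and WKB solutions
`u_± = u_±(·; x₀, x̃)`, `v_± = u_±(·; y₀, ỹ)` with amplitude symbols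
`wE, wO` and `vE, vO` respectively, one has, for every
`x ∈ Ω_±(x̃) ∩ Ω_±(ỹ)`:
`W(u_±, v_±) = ±2i exp(±(z₁+z₂)/h) (wO·vE' − wE·vO')`. -/
theorem wronskian_wkb_same_sign
    (hp m c E : ℝ) (hhp : 0 < hp) (hm : 0 ≤ m) (hc : 0 < c)
    (V : ℂ → ℂ) (s : ℝ) (hs : s = 1 ∨ s = -1)
    (Ω : Set ℂ) (hΩopen : IsOpen Ω)
    (x₀ y₀ : ℂ) (hx₀ : x₀ ∈ Ω) (hy₀ : y₀ ∈ Ω)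
    (gp gm p Hf z₁ z₂ : ℂ → ℂ)
    (hgp : ∀ x ∈ Ω, gp x = (-((m : ℂ) * (c : ℂ) ^ 2) - (V x - (E : ℂ))) / (c : ℂ))
    (hgm : ∀ x ∈ Ω, gm x = (-((m : ℂ) * (c : ℂ) ^ 2) + (V x - (E : ℂ))) / (c : ℂ))
    (hnoturn : ∀ x ∈ Ω, gp x * gm x ≠ 0)
    (hpsq : ∀ x ∈ Ω, (p x) ^ 2 = gp x * gm x)
    (hH4 : ∀ x ∈ Ω, (Hf x) ^ 4 = gm x / gp x)
    (hz₁ : ∀ x ∈ Ω, HasDerivAt z₁ (p x) x) (hz₁0 : z₁ x₀ = 0)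
    (hz₂ : ∀ x ∈ Ω, HasDerivAt z₂ (p x) x) (hz₂0 : z₂ y₀ = 0)
    (xt yt : ℂ) (hxt : xt ∈ Ω) (hyt : yt ∈ Ω)
    (wE wO vE vO : ℂ → ℂ)
    (u v : ℂ → ℂ × ℂ)
    (hu : ∀ x ∈ OmegaPM Ω z₁ s xt ∩ OmegaPM Ω z₁ s yt, u x = WKBsol hp s z₁ Hf wE wO x)
    (hv : ∀ x ∈ OmegaPM Ω z₁ s xt ∩ OmegaPM Ω z₁ s yt, v x = WKBsol hp s z₂ Hf vE vO x) :
    ∀ x ∈ OmegaPM Ω z₁ s xt ∩ OmegaPM Ω z₁ s yt,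
      Wron (u x) (v x) =
        (s : ℂ) * 2 * Complex.I * Complex.exp ((s : ℂ) * (z₁ x + z₂ x) / (hp : ℂ))
          * (wO x * vE x - wE x * vO x) := by
  rintro x hx
  have hH : Hf x ≠ 0 := by
    intro h0
    have h4 := hH4 x hx.1.1
    rw [h0, zero_pow four_ne_zero] at h4
    have hne := hnoturn x hx.1.1
    exact div_ne_zero (right_ne_zero_of_mul hne) (left_ne_zero_of_mul hne) h4.symm
  have hexp : Complex.exp ((s : ℂ) * (z₁ x + z₂ x) / (hp : ℂ)) =
      Complex.exp ((s : ℂ) * z₁ x / (hp : ℂ)) * Complex.exp ((s : ℂ) * z₂ x / (hp : ℂ)) := by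
    rw [← Complex.exp_add, mul_add, add_div]
  rw [hu x hx, hv x hx, hexp]
  simp only [Wron, WKBsol]
  field_simp
  ring

end
end

section
/- Wronskian formula for WKB solutions with opposite exponent signs (Lemma 3.8, second part): Let x₀, y₀ ∈ Ω(E) and let x̃, ỹ be amplitude base points with Ω_±(x̃) ∩ Ω_∓(ỹ) ≠ ∅. Then for every x ∈ Ω_±(x̃) ∩ Ω_∓(ỹ): W(u_±(x; x₀, x̃), u_∓(x; y₀, ỹ)) = ±2i·exp(±(1/h)(z(x; x₀) − z(x; y₀)))·(w_±^odd(x; x₀, x̃)·w_∓^odd(x; y₀, ỹ) − w_±^even(x; x₀, x̃)·w_∓^even(x; y₀, ỹ)). -/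
open Complex Filter Topology Set

noncomputable section

/-- **Wronskian formula for complex WKB solutions with opposite exponent signs**
(Lemma 3.8, second part).  With `g_± = (−mc² ∓ (V−E))/c`, `p² = g₊g₋`,
`H⁴ = g₋/g₊`, phases `z₁ = z(·;x₀)`, `z₂ = z(·;y₀)` (primitives of `p`
vanishing at the phase base points `x₀, y₀ ∈ Ω(E)`), and WKB solutions
`u_± = u_±(·; x₀, x̃)` of sign `s`, `v_∓ = u_∓(·; y₀, ỹ)` of sign `−s`, with
amplitude symbols `wE, wO` and `vE, vO` respectively, one has, for every
`x ∈ Ω_±(x̃) ∩ Ω_∓(ỹ)`: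
`W(u_±, v_∓) = ±2i exp(±(z₁−z₂)/h) (wO·vO' − wE·vE')`. -/
theorem wronskian_wkb_opposite_sign
    (hp m c E : ℝ) (hhp : 0 < hp) (hm : 0 ≤ m) (hc : 0 < c)
    (V : ℂ → ℂ) (s : ℝ) (hs : s = 1 ∨ s = -1)
    (Ω : Set ℂ) (hΩopen : IsOpen Ω)
    (x₀ y₀ : ℂ) (hx₀ : x₀ ∈ Ω) (hy₀ : y₀ ∈ Ω)
    (gp gm p Hf z₁ z₂ : ℂ → ℂ)
    (hgp : ∀ x ∈ Ω, gp x = (-((m : ℂ) * (c : ℂ) ^ 2) - (V x - (E : ℂ))) / (c : ℂ))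
    (hgm : ∀ x ∈ Ω, gm x = (-((m : ℂ) * (c : ℂ) ^ 2) + (V x - (E : ℂ))) / (c : ℂ))
    (hnoturn : ∀ x ∈ Ω, gp x * gm x ≠ 0)
    (hpsq : ∀ x ∈ Ω, (p x) ^ 2 = gp x * gm x)
    (hH4 : ∀ x ∈ Ω, (Hf x) ^ 4 = gm x / gp x)
    (hz₁ : ∀ x ∈ Ω, HasDerivAt z₁ (p x) x) (hz₁0 : z₁ x₀ = 0)
    (hz₂ : ∀ x ∈ Ω, HasDerivAt z₂ (p x) x) (hz₂0 : z₂ y₀ = 0)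
    (xt yt : ℂ) (hxt : xt ∈ Ω) (hyt : yt ∈ Ω)
    (wE wO vE vO : ℂ → ℂ)
    (u v : ℂ → ℂ × ℂ)
    (hu : ∀ x ∈ OmegaPM Ω z₁ s xt ∩ OmegaPM Ω z₁ (-s) yt, u x = WKBsol hp s z₁ Hf wE wO x)
    (hv : ∀ x ∈ OmegaPM Ω z₁ s xt ∩ OmegaPM Ω z₁ (-s) yt, v x = WKBsol hp (-s) z₂ Hf vE vO x) :
    ∀ x ∈ OmegaPM Ω z₁ s xt ∩ OmegaPM Ω z₁ (-s) yt,
      Wron (u x) (v x) =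
        (s : ℂ) * 2 * Complex.I * Complex.exp ((s : ℂ) * (z₁ x - z₂ x) / (hp : ℂ))
          * (wO x * vO x - wE x * vE x) := by
  rintro x hx
  have hH : Hf x ≠ 0 := by
    intro h0
    have h4 := hH4 x hx.1.1
    rw [h0, zero_pow four_ne_zero, eq_comm, div_eq_zero_iff] at h4
    apply hnoturn x hx.1.1
    rcases h4 with h | h <;> simp [h]
  have hexp : Complex.exp ((s : ℂ) * (z₁ x - z₂ x) / (hp : ℂ)) =
      Complex.exp ((s : ℂ) * z₁ x / (hp : ℂ)) * Complex.exp (-(s : ℂ) * z₂ x / (hp : ℂ)) := by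
    rw [← Complex.exp_add]
    congr 1
    ring
  rw [hu x hx, hv x hx, hexp]
  simp only [Wron, WKBsol, Complex.ofReal_neg]
  field_simp
  ring

end
end
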